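/- Let ℓ and n be integers with ℓ ≥ 2 and 1 ≤ n ≤ ℓ − 1. Let ξ : Fin ℓ → ℝ satisfy ∑_m ξ_m² = 1, and let A : Finset (Fin ℓ) × Fin ℓ → ℝ satisfy A(I, i) = 0 unless (I.card = n and i ∉ I), together with ∑_{I, i} A(I, i)² = 1. Then ∑_{i} ∑_{I' : I'.card = n−1} ( ∑_{m ∉ I'} A(insert m I', i) · ξ_m )² ≤ (ℓ − n) · ( 1 − ∑_{I, i} A(I, i)² · ( ∑_{k ∉ I} ξ_k² ) ). -/

import Mathlib

theorem reindex_aux (ℓ n : ℕ) (hn : 1 ≤ n) (f : Finset (Fin ℓ) → Fin ℓ → ℝ) :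
    ∑ I' ∈ Finset.univ.filter (fun I' : Finset (Fin ℓ) => I'.card = n - 1),
      ∑ m ∈ I'ᶜ, f (insert m I') m
    = ∑ I ∈ Finset.univ.filter (fun I : Finset (Fin ℓ) => I.card = n), ∑ m ∈ I, f I m := by
  rw [Finset.sum_sigma', Finset.sum_sigma']
  refine Finset.sum_bij' (fun p _ => ⟨insert p.2 p.1, p.2⟩) (fun p _ => ⟨p.1.erase p.2, p.2⟩)
    ?_ ?_ ?_ ?_ ?_
  · rintro ⟨I, m⟩ h
    simp only [Finset.mem_sigma, Finset.mem_filter, Finset.mem_univ, true_and,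
      Finset.mem_compl] at h ⊢
    rw [Finset.card_insert_of_notMem h.2]
    exact ⟨by omega, Finset.mem_insert_self _ _⟩
  · rintro ⟨I, m⟩ h
    simp only [Finset.mem_sigma, Finset.mem_filter, Finset.mem_univ, true_and,
      Finset.mem_compl] at h ⊢
    rw [Finset.card_erase_of_mem h.2]
    exact ⟨by omega, Finset.notMem_erase _ _⟩
  · rintro ⟨I, m⟩ h
    simp only [Finset.mem_sigma, Finset.mem_compl] at h
    simp [Finset.erase_insert h.2]
  · rintro ⟨I, m⟩ h
    simp only [Finset.mem_sigma] at h
    simp [Finset.insert_erase h.2]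
  · rintro ⟨I, m⟩ h
    rfl

/-- The second Cauchy–Schwarz inequality (eq. ex_val_ineq2) in Appendix A of the paper,
used in the proof of the odd-particle-number pseudoprojector norm bound. -/
theorem ex_val_ineq2 (ℓ n : ℕ) (hℓ : 2 ≤ ℓ) (hn : 1 ≤ n) (hnℓ : n ≤ ℓ - 1)
    (ξ : Fin ℓ → ℝ) (hξ : ∑ m, ξ m ^ 2 = 1)
    (A : Finset (Fin ℓ) × Fin ℓ → ℝ)
    (hA0 : ∀ (I : Finset (Fin ℓ)) (i : Fin ℓ), ¬ (I.card = n ∧ i ∉ I) → A (I, i) = 0)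
    (hA1 : ∑ p : Finset (Fin ℓ) × Fin ℓ, A p ^ 2 = 1) :
    ∑ i : Fin ℓ, ∑ I' ∈ Finset.univ.filter (fun I' : Finset (Fin ℓ) => I'.card = n - 1),
        (∑ m ∈ I'ᶜ, A (insert m I', i) * ξ m) ^ 2
      ≤ ((ℓ : ℝ) - n) *
          (1 - ∑ p : Finset (Fin ℓ) × Fin ℓ, A p ^ 2 * (∑ k ∈ p.1ᶜ, ξ k ^ 2)) := by
  have hpos : (0 : ℝ) ≤ (ℓ : ℝ) - n := by
    have : (n : ℝ) ≤ ℓ := by exact_mod_cast (by omega : n ≤ ℓ)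
    linarith
  have hR : 1 - ∑ p : Finset (Fin ℓ) × Fin ℓ, A p ^ 2 * (∑ k ∈ p.1ᶜ, ξ k ^ 2)
      = ∑ i : Fin ℓ, ∑ I ∈ Finset.univ.filter (fun I : Finset (Fin ℓ) => I.card = n),
          ∑ m ∈ I, (A (I, i) * ξ m) ^ 2 := by
    rw [← hA1, ← Finset.sum_sub_distrib, Fintype.sum_prod_type_right]
    refine Finset.sum_congr rfl fun i _ => ?_
    rw [Finset.sum_filter]
    refine Finset.sum_congr rfl fun I _ => ?_
    split_ifs with h
    · have := Finset.sum_add_sum_compl I (fun m => ξ m ^ 2)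
      rw [hξ] at this
      simp only [mul_pow, ← Finset.mul_sum]
      linear_combination (-(A (I, i)) ^ 2) * this
    · rw [hA0 I i (fun h' => h h'.1)]; simp
  rw [hR, Finset.mul_sum]
  refine Finset.sum_le_sum fun i _ => ?_
  rw [← reindex_aux ℓ n hn (fun I m => (A (I, i) * ξ m) ^ 2), Finset.mul_sum]
  refine Finset.sum_le_sum fun I' hI' => ?_
  have hc : I'.card = n - 1 := by simpa using hI'
  by_cases hi : i ∈ I'
  · have h0 : ∑ m ∈ I'ᶜ, A (insert m I', i) * ξ m = 0 :=
      Finset.sum_eq_zero fun m _ => by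
        rw [hA0 _ _ (fun h' => h'.2 (Finset.mem_insert_of_mem hi)), zero_mul]
    rw [h0]
    have : 0 ≤ ∑ m ∈ I'ᶜ, (A (insert m I', i) * ξ m) ^ 2 :=
      Finset.sum_nonneg fun _ _ => sq_nonneg _
    have := mul_nonneg hpos this
    simpa using this
  · have hi' : i ∈ I'ᶜ := by simpa using hi
    have hz : A (insert i I', i) = 0 := hA0 _ _ (fun h' => h'.2 (Finset.mem_insert_self _ _))
    have hcard : (((I'ᶜ).erase i).card : ℝ) = (ℓ : ℝ) - n := by
      rw [Finset.card_erase_of_mem hi', Finset.card_compl, Fintype.card_fin, hc,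
        show ℓ - (n - 1) - 1 = ℓ - n by omega, Nat.cast_sub (by omega)]
    rw [← Finset.add_sum_erase _ _ hi',
      ← Finset.add_sum_erase _ (fun m => (A (insert m I', i) * ξ m) ^ 2) hi', hz, ← hcard]
    simpa using sq_sum_le_card_mul_sum_sq (s := (I'ᶜ).erase i)
      (f := fun m => A (insert m I', i) * ξ m)
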